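/- A real square matrix A is power positive (A^k > 0 for some k ≥ 1) if and only if either A or −A is eventually positive. -/

import Mathlib

open Matrix

lemma pp_mulVec_pos {n : ℕ} (B : Matrix (Fin n) (Fin n) ℝ) (hB : ∀ i j, 0 < B i j)
    (x : Fin n → ℝ) (hx : ∀ i, 0 ≤ x i) (hx0 : x ≠ 0) (i : Fin n) : 0 < (B *ᵥ x) i := by
  obtain ⟨l, hl⟩ := Function.ne_iff.mp hx0
  have hl' : 0 < x l := lt_of_le_of_ne (hx l) (Ne.symm hl)
  show 0 < ∑ j, B i j * x j
  exact Finset.sum_pos' (fun j _ => mul_nonneg (hB i j).le (hx j))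
    ⟨l, Finset.mem_univ _, mul_pos (hB i l) hl'⟩

lemma pp_perron {n : ℕ} [Nonempty (Fin n)] (B : Matrix (Fin n) (Fin n) ℝ)
    (hB : ∀ i j, 0 < B i j) :
    ∃ (t : ℝ) (v : Fin n → ℝ), (∀ i, 0 < v i) ∧ 0 < t ∧ B *ᵥ v = t • v := by
  set M : ℝ := ∑ i, ∑ j, B i j with hM
  have hM0 : 0 ≤ M := Finset.sum_nonneg fun i _ => Finset.sum_nonneg fun j _ => (hB i j).le
  have hbound : ∀ (x : Fin n → ℝ) (t : ℝ), x ∈ stdSimplex ℝ (Fin n) →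
      (∀ i, t * x i ≤ (B *ᵥ x) i) → t ≤ M := by
    intro x t hx h
    have h1 : ∑ i, t * x i ≤ ∑ i, (B *ᵥ x) i := Finset.sum_le_sum fun i _ => h i
    rw [← Finset.mul_sum, hx.2, mul_one] at h1
    refine h1.trans (Finset.sum_le_sum fun i _ => ?_)
    show ∑ j, B i j * x j ≤ _
    refine Finset.sum_le_sum fun j _ => ?_
    have : x j ≤ 1 := by
      rw [← hx.2]
      exact Finset.single_le_sum (fun i _ => hx.1 i) (Finset.mem_univ j)
    nlinarith [hB i j]
  let T : Set ((Fin n → ℝ) × ℝ) :=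
    (stdSimplex ℝ (Fin n) ×ˢ Set.Icc 0 M) ∩ {p | ∀ i, p.2 * p.1 i ≤ (B *ᵥ p.1) i}
  have hTc : IsCompact T := by
    refine ((isCompact_stdSimplex ℝ (Fin n)).prod isCompact_Icc).inter_right ?_
    rw [Set.ofPred_forall]
    refine isClosed_iInter fun i => isClosed_le (by fun_prop) ?_
    show Continuous fun p : (Fin n → ℝ) × ℝ => ∑ j, B i j * p.1 j
    fun_prop
  have hTn : T.Nonempty := by
    obtain ⟨i⟩ := ‹Nonempty (Fin n)›
    refine ⟨(Pi.single i 1, 0), ⟨single_mem_stdSimplex ℝ i, by simp [hM0]⟩, ?_⟩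
    intro j
    simp [(hB j i).le]
  obtain ⟨⟨x, t⟩, hxt, hmax⟩ := hTc.exists_isMaxOn hTn (f := Prod.snd) continuous_snd.continuousOn
  obtain ⟨⟨hx, ht⟩, hle⟩ := hxt
  simp only [Set.mem_ofPred_eq] at hx ht hle
  have hx0 : x ≠ 0 := by
    rintro rfl
    have := hx.2
    simp at this
  have hpos := pp_mulVec_pos B hB x hx.1 hx0
  have heq : B *ᵥ x = t • x := by
    by_contra hne
    set y := B *ᵥ x with hy
    have hz : ∀ i, 0 < (B *ᵥ (y - t • x)) i :=
      pp_mulVec_pos B hB _ (fun i => by simpa using hle i) (sub_ne_zero.mpr hne)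
    have hs : 0 < ∑ i, y i := Finset.sum_pos (fun i _ => hpos i) Finset.univ_nonempty
    obtain ⟨i0, hi0⟩ := Finite.exists_min (fun i => (B *ᵥ (y - t • x)) i / y i)
    set e := (B *ᵥ (y - t • x)) i0 / y i0 with he
    have he0 : 0 < e := div_pos (hz i0) (hpos i0)
    have hyy : ∀ i, (t + e) * y i ≤ (B *ᵥ y) i := by
      intro i
      have h1 := hi0 i
      rw [le_div_iff₀ (hpos i)] at h1
      rw [mulVec_sub, mulVec_smul, ← hy] at h1
      simp only [Pi.sub_apply, Pi.smul_apply, smul_eq_mul] at h1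
      linarith
    set s := ∑ i, y i
    have hmem : s⁻¹ • y ∈ stdSimplex ℝ (Fin n) := by
      refine ⟨fun i => mul_nonneg (inv_nonneg.mpr hs.le) (hpos i).le, ?_⟩
      simp only [Pi.smul_apply, smul_eq_mul]
      rw [← Finset.mul_sum]
      exact inv_mul_cancel₀ hs.ne'
    have hyy' : ∀ i, (t + e) * (s⁻¹ • y) i ≤ (B *ᵥ (s⁻¹ • y)) i := by
      intro i
      rw [mulVec_smul]
      simp only [Pi.smul_apply, smul_eq_mul]
      have := mul_le_mul_of_nonneg_left (hyy i) (inv_nonneg.mpr hs.le)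
      linarith
    have hT : (s⁻¹ • y, t + e) ∈ T :=
      ⟨⟨hmem, ⟨by have := ht.1; simp only at this ⊢; linarith, hbound _ _ hmem hyy'⟩⟩, hyy'⟩
    have := hmax hT
    simp only [Set.mem_ofPred_eq] at this
    linarith
  have htx : ∀ i, 0 < t * x i := fun i => by
    have := hpos i
    rw [heq] at this
    simpa using this
  have ht0 : 0 < t := by
    obtain ⟨i⟩ := ‹Nonempty (Fin n)›
    exact pos_of_mul_pos_left (htx i) (hx.1 i)
  exact ⟨t, x, fun i => (pos_iff_pos_of_mul_pos (htx i)).mp ht0, ht0, heq⟩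

lemma pp_unique {n : ℕ} [Nonempty (Fin n)] (B : Matrix (Fin n) (Fin n) ℝ)
    (hB : ∀ i j, 0 < B i j) (t : ℝ) (v u : Fin n → ℝ) (hv : ∀ i, 0 < v i)
    (hBv : B *ᵥ v = t • v) (hBu : B *ᵥ u = t • u) : ∃ c : ℝ, u = c • v := by
  obtain ⟨i0, hi0⟩ := Finite.exists_min (fun i => u i / v i)
  refine ⟨u i0 / v i0, ?_⟩
  set c := u i0 / v i0 with hc
  by_contra hne
  have h := pp_mulVec_pos B hB (u - c • v) (fun i => by
    have := hi0 i
    rw [le_div_iff₀ (hv i)] at this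
    simpa using this) (sub_ne_zero.mpr hne) i0
  rw [mulVec_sub, mulVec_smul, hBv, hBu] at h
  simp only [Pi.sub_apply, Pi.smul_apply, smul_eq_mul] at h
  have : c * v i0 = u i0 := div_mul_cancel₀ _ (hv i0).ne'
  have h2 : t * u i0 - c * (t * v i0) = t * (u i0 - c * v i0) := by ring
  rw [h2, this] at h
  simp at h

lemma pp_pow_one {n : ℕ} (P : Matrix (Fin n) (Fin n) ℝ) (v : Fin n → ℝ) (c : ℝ)
    (h : P *ᵥ v = c • v) (m : ℕ) : (P ^ m) *ᵥ v = c ^ m • v := by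
  induction m with
  | zero => simp
  | succ m ih => rw [pow_succ, ← mulVec_mulVec, h, mulVec_smul, ih, smul_smul, pow_succ, mul_comm]

lemma pp_contract {n : ℕ} [Nonempty (Fin n)] (S : Matrix (Fin n) (Fin n) ℝ) (δ : ℝ)
    (hδ : 0 < δ) (hS : ∀ i j, δ ≤ S i j) (hS1 : ∀ i, ∑ j, S i j = 1) (j : Fin n) (q : ℕ) :
    ∃ a, δ ≤ a ∧ ∀ i, a ≤ (S ^ (q + 1)) i j ∧ (S ^ (q + 1)) i j ≤ a + (1 - δ) ^ q := by
  induction q with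
  | zero =>
    refine ⟨δ, le_rfl, fun i => ⟨by simpa using hS i j, ?_⟩⟩
    have : S i j ≤ 1 := by
      rw [← hS1 i]
      exact Finset.single_le_sum (fun l _ => hδ.le.trans (hS i l)) (Finset.mem_univ j)
    simp only [zero_add, pow_one, pow_zero]
    linarith
  | succ q ih =>
    obtain ⟨a, ha, h⟩ := ih
    obtain ⟨l⟩ := ‹Nonempty (Fin n)›
    set X := S ^ (q + 1) with hX
    set d := (1 - δ) ^ q with hd
    have hy := h l
    refine ⟨a + δ * (X l j - a), by nlinarith, fun i => ?_⟩
    rw [pow_succ' S (q + 1), ← hX, mul_apply, pow_succ, ← hd]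
    have hlo : S i l * (X l j - a) ≤ ∑ k, S i k * (X k j - a) :=
      Finset.single_le_sum (f := fun k => S i k * (X k j - a))
        (fun k _ => mul_nonneg (hδ.le.trans (hS i k)) (by linarith [h k])) (Finset.mem_univ l)
    have hhi : S i l * (a + d - X l j) ≤ ∑ k, S i k * (a + d - X k j) :=
      Finset.single_le_sum (f := fun k => S i k * (a + d - X k j))
        (fun k _ => mul_nonneg (hδ.le.trans (hS i k)) (by linarith [h k])) (Finset.mem_univ l)
    simp only [mul_sub, Finset.sum_sub_distrib, ← Finset.sum_mul, hS1] at hlo hhi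
    have := hS i l
    constructor <;> nlinarith

lemma pp_core {n : ℕ} [Nonempty (Fin n)] (P : Matrix (Fin n) (Fin n) ℝ) (hP : P *ᵥ 1 = 1)
    (k : ℕ) (hk : 1 ≤ k) (hpos : ∀ i j, 0 < (P ^ k) i j) :
    ∃ m₀ : ℕ, ∀ m : ℕ, m₀ ≤ m → ∀ i j, 0 < (P ^ m) i j := by
  have hrow : ∀ m i, ∑ j, (P ^ m) i j = 1 := by
    intro m i
    have := congrFun (pp_pow_one P 1 1 (by simpa using hP) m) i
    simpa [mulVec, dotProduct] using this
  obtain ⟨⟨i0, j0⟩, hmin⟩ := Finite.exists_min (fun p : Fin n × Fin n => (P ^ k) p.1 p.2)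
  set δ := (P ^ k) i0 j0 with hδ
  have hδ0 : 0 < δ := hpos i0 j0
  have hδ1 : δ ≤ 1 := by
    rw [← hrow k i0]
    exact Finset.single_le_sum (f := fun j => (P ^ k) i0 j)
      (fun l _ => (hpos i0 l).le) (Finset.mem_univ j0)
  set K : ℝ := ∑ r ∈ Finset.range k, ∑ i, ∑ l, |(P ^ r) i l| with hK
  have hKb : ∀ r < k, ∀ i, ∑ l, |(P ^ r) i l| ≤ K := by
    intro r hr i
    refine le_trans ?_ (Finset.single_le_sum (f := fun r => ∑ i, ∑ l, |(P ^ r) i l|)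
      (fun r _ => by positivity) (Finset.mem_range.mpr hr))
    exact Finset.single_le_sum (f := fun i => ∑ l, |(P ^ r) i l|)
      (fun r _ => by positivity) (Finset.mem_univ i)
  have hK0 : 0 ≤ K := by positivity
  obtain ⟨Q, hQ⟩ := exists_pow_lt_of_lt_one (show 0 < δ / (K + 1) by positivity)
    (show 1 - δ < 1 by linarith)
  refine ⟨k * (Q + 1), fun m hm i j => ?_⟩
  have hq : Q + 1 ≤ m / k := (Nat.le_div_iff_mul_le hk).mpr (by rwa [mul_comm])
  obtain ⟨q, hqe⟩ : ∃ q, m / k = q + 1 := ⟨m / k - 1, by omega⟩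
  have hr : m % k < k := Nat.mod_lt _ hk
  obtain ⟨a, ha, h⟩ := pp_contract (P ^ k) δ hδ0 (fun i j => hmin (i, j)) (hrow k) j q
  have hm' : P ^ m = P ^ (m % k) * (P ^ k) ^ (q + 1) := by
    rw [← pow_mul, ← pow_add, ← hqe, Nat.mod_add_div]
  rw [hm', mul_apply]
  set X := (P ^ k) ^ (q + 1)
  have hd : (1 - δ) ^ q < δ / (K + 1) :=
    lt_of_le_of_lt (pow_le_pow_of_le_one (by linarith) (by linarith) (by omega)) hQ
  have hd0 : 0 ≤ (1 - δ) ^ q := pow_nonneg (by linarith) _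
  rw [lt_div_iff₀ (by positivity)] at hd
  have h1 : ∑ l, -(|(P ^ (m % k)) i l| * (1 - δ) ^ q) ≤
      ∑ l, (P ^ (m % k)) i l * (X l j - a) := by
    refine Finset.sum_le_sum fun l _ => ?_
    have h2 : |(P ^ (m % k)) i l * (X l j - a)| ≤ |(P ^ (m % k)) i l| * (1 - δ) ^ q := by
      rw [abs_mul]
      refine mul_le_mul_of_nonneg_left ?_ (abs_nonneg _)
      rw [abs_of_nonneg] <;> linarith [h l]
    exact (abs_le.mp h2).1
  simp only [mul_sub, Finset.sum_sub_distrib, Finset.sum_neg_distrib, ← Finset.sum_mul,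
    hrow] at h1
  have := mul_le_mul_of_nonneg_right (hKb _ hr i) hd0
  linarith

theorem stmt_18 {n : ℕ} (A : Matrix (Fin n) (Fin n) ℝ) :
    (∃ k : ℕ, 1 ≤ k ∧ ∀ i j, 0 < (A ^ k) i j) ↔
    ((∃ m₀ : ℕ, ∀ m : ℕ, m₀ ≤ m → ∀ i j, 0 < (A ^ m) i j) ∨
     (∃ m₀ : ℕ, ∀ m : ℕ, m₀ ≤ m → ∀ i j, 0 < ((-A) ^ m) i j)) := by
  constructor
  · rintro ⟨k, hk, hA⟩
    rcases isEmpty_or_nonempty (Fin n) with he | hne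
    · exact Or.inl ⟨0, fun m _ i => he.elim i⟩
    obtain ⟨t, v, hv, ht, hBv⟩ := pp_perron (A ^ k) hA
    obtain ⟨c, hc⟩ := pp_unique (A ^ k) hA t v (A *ᵥ v) hv hBv (by
      rw [mulVec_mulVec, ← pow_succ, pow_succ', ← mulVec_mulVec, hBv, mulVec_smul])
    have hck : 0 < c ^ k := by
      have h1 := pp_pow_one A v c hc k
      rw [hBv] at h1
      obtain ⟨i⟩ := hne
      have h2 := congrFun h1 i
      simp only [Pi.smul_apply, smul_eq_mul] at h2
      rw [← mul_right_cancel₀ (hv i).ne' h2]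
      exact ht
    have hc0 : c ≠ 0 := by
      rintro rfl
      rw [zero_pow (by omega)] at hck
      exact lt_irrefl _ hck
    let P : Matrix (Fin n) (Fin n) ℝ := Matrix.of fun i j => c⁻¹ * ((v i)⁻¹ * A i j * v j)
    have hPm : ∀ m i j, (P ^ m) i j = (c ^ m)⁻¹ * ((v i)⁻¹ * (A ^ m) i j * v j) := by
      intro m
      induction m with
      | zero =>
        intro i j
        by_cases hij : i = j
        · subst hij
          simp [(hv i).ne']
        · simp [hij]
      | succ m ih =>
        intro i j
        rw [pow_succ, mul_apply, pow_succ A, mul_apply, Finset.mul_sum, Finset.sum_mul,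
          Finset.mul_sum]
        refine Finset.sum_congr rfl fun l _ => ?_
        rw [ih]
        have := (hv l).ne'
        have := (hv i).ne'
        simp only [P, Matrix.of_apply]
        field_simp
        ring
    have hP1 : P *ᵥ 1 = 1 := by
      ext i
      have h2 := congrFun hc i
      simp only [mulVec, dotProduct, Pi.smul_apply, smul_eq_mul] at h2
      simp only [mulVec, dotProduct, P, Matrix.of_apply, Pi.one_apply, mul_one, mul_assoc]
      rw [← Finset.mul_sum, ← Finset.mul_sum, h2]
      have := (hv i).ne'
      field_simp
    obtain ⟨m₀, hm₀⟩ := pp_core P hP1 k hk (fun i j => by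
      rw [hPm]
      have := hv i
      have := hv j
      have := hA i j
      positivity)
    have key : ∀ m, m₀ ≤ m → ∀ i j, 0 < (c ^ m)⁻¹ * (A ^ m) i j := by
      intro m hm i j
      have h := hm₀ m hm i j
      rw [hPm] at h
      have hi := hv i
      have hj := hv j
      have h3 : (c ^ m)⁻¹ * (A ^ m) i j =
          ((c ^ m)⁻¹ * ((v i)⁻¹ * (A ^ m) i j * v j)) * (v i * (v j)⁻¹) := by
        field_simp
      rw [h3]
      exact mul_pos h (by positivity)
    rcases lt_or_gt_of_ne hc0 with hneg | hpos
    · right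
      refine ⟨m₀, fun m hm i j => ?_⟩
      have h := key m hm i j
      have hnc : 0 < (-c) ^ m := pow_pos (by linarith) m
      have h4 : ((-A) ^ m) i j = (-c) ^ m * ((c ^ m)⁻¹ * (A ^ m) i j) := by
        rcases Nat.even_or_odd m with he | ho
        · rw [he.neg_pow, he.neg_pow]
          field_simp
        · rw [ho.neg_pow, ho.neg_pow, Matrix.neg_apply]
          field_simp
      rw [h4]
      exact mul_pos hnc h
    · left
      refine ⟨m₀, fun m hm i j => ?_⟩
      have h := key m hm i j
      have hcm : 0 < (c ^ m)⁻¹ := by positivity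
      exact (pos_iff_pos_of_mul_pos h).mp hcm
  · rintro (⟨m₀, h⟩ | ⟨m₀, h⟩)
    · exact ⟨m₀ + 1, by omega, h _ (by omega)⟩
    · refine ⟨2 * (m₀ + 1), by omega, fun i j => ?_⟩
      have := h (2 * (m₀ + 1)) (by omega) i j
      rwa [(even_two_mul _).neg_pow] at this
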